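/- Fix γ = ((A, B), (C, D)) ∈ Sp_n(ℝ). The map Z ↦ γZ = (AZ+B)(CZ+D)⁻¹ from ℍ_n (an open subset of the complex vector space of symmetric n×n complex matrices) to itself is complex differentiable, and its derivative at Z ∈ ℍ_n applied to a direction H in the space of symmetric n×n complex matrices equals (CZ+D)⁻ᵗ · H · (CZ+D)⁻¹. -/

import Mathlib

open Matrix Complex

noncomputable section

abbrev McM (n : ℕ) := Matrix (Fin n) (Fin n) ℂ
abbrev MrM (n : ℕ) := Matrix (Fin n) (Fin n) ℝ

variable {n : ℕ}

/-- Entrywise coercion of a real matrix to a complex matrix. -/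
def cmapM (A : MrM n) : McM n := A.map (fun x => (x : ℂ))

/-- Entrywise complex conjugate of a complex matrix. -/
def mconj (Z : McM n) : McM n := Z.map (starRingEnd ℂ)

/-- Entrywise imaginary part of a complex matrix. -/
def matIm (Z : McM n) : MrM n := Matrix.of fun j k => (Z j k).im

/-- Membership in the Siegel upper half-space `ℍ_n`:
`Z` is symmetric and `Im Z` is positive definite. -/
def inSiegel (Z : McM n) : Prop := Z.IsSymm ∧ (matIm Z).PosDef

/-- The symplectic condition `γᵀ J_n γ = J_n`, in `n × n` block form. -/
def IsSymplectic (A B C D : MrM n) : Prop :=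
  (Matrix.fromBlocks A B C D)ᵀ * Matrix.fromBlocks (0 : MrM n) 1 (-1) 0 *
      Matrix.fromBlocks A B C D = Matrix.fromBlocks 0 1 (-1) 0

/-- The symplectic action `γZ = (AZ+B)(CZ+D)⁻¹` on the Siegel upper half-space. -/
def actS (A B C D : MrM n) (Z : McM n) : McM n :=
  (cmapM A * Z + cmapM B) * (cmapM C * Z + cmapM D)⁻¹

attribute [local instance] Matrix.normedAddCommGroup Matrix.normedSpace

/-- The derivative of a noncommutative Möbius transformation at a point with invertible
denominator. -/
theorem hasFDerivAt_moebius {R : Type*} [NormedRing R] [NormedAlgebra ℂ R] [CompleteSpace R]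
    (a b c d z : R) (h : IsUnit (c * z + d)) :
    HasFDerivAt (fun w : R => (a * w + b) * Ring.inverse (c * w + d))
      (ContinuousLinearMap.mulLeftRight ℂ R
        (a - (a * z + b) * Ring.inverse (c * z + d) * c) (Ring.inverse (c * z + d))) z := by
  have affine (p q : R) : HasFDerivAt (fun w : R => p * w + q) (ContinuousLinearMap.mul ℂ R p) z :=
    (ContinuousLinearMap.mul ℂ R p).hasFDerivAt.add_const q
  obtain ⟨u, hu⟩ := h
  have hinv := hasFDerivAt_ringInverse (𝕜 := ℂ) u
  rw [hu] at hinv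
  refine ((affine a b).mul' (hinv.comp z (affine c d))).congr_fderiv ?_
  ext w
  simp [← hu]
  noncomm_ring

/-- The derivative of a matrix Möbius transformation at a point with invertible denominator. -/
theorem hasFDerivAt_matrix_moebius (a b c d Z : McM n) (h : IsUnit (c * Z + d)) :
    HasFDerivAt (fun W : McM n => (a * W + b) * (c * W + d)⁻¹)
      (((LinearMap.mulLeft ℂ (a - (a * Z + b) * (c * Z + d)⁻¹ * c)).comp
        (LinearMap.mulRight ℂ (c * Z + d)⁻¹)).toContinuousLinearMap) Z := by
  have key := @hasFDerivAt_moebius (McM n) Matrix.linftyOpNormedRing Matrix.linftyOpNormedAlgebra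
    (inferInstanceAs (CompleteSpace (Fin n → Fin n → ℂ))) a b c d Z h
  simp only [Matrix.nonsing_inv_eq_ringInverse]
  refine HasFDerivAt.congr_fderiv (f' := _) key ?_
  ext1 H
  exact mul_assoc _ _ _

/-- A complex vector killed by the Hermitian form of a real positive definite matrix is zero. -/
theorem eq_zero_of_posDef_of_star_dotProduct {Y : MrM n} (hY : Y.PosDef) {v : Fin n → ℂ}
    (hv : star v ⬝ᵥ (cmapM Y *ᵥ v) = 0) : v = 0 := by
  set x : Fin n → ℝ := fun i => (v i).re
  set y : Fin n → ℝ := fun i => (v i).im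
  have hsum : x ⬝ᵥ (Y *ᵥ x) + y ⬝ᵥ (Y *ᵥ y) = 0 := by
    have := congrArg Complex.re hv
    simpa [dotProduct, mulVec, cmapM, x, y, Finset.sum_add_distrib] using this
  have hx0 := hY.posSemidef.dotProduct_mulVec_nonneg x
  have hy0 := hY.posSemidef.dotProduct_mulVec_nonneg y
  rw [star_trivial] at hx0 hy0
  have hx : x = 0 := by
    by_contra hx
    have := hY.dotProduct_mulVec_pos hx
    rw [star_trivial] at this
    linarith
  have hy : y = 0 := by
    by_contra hy
    have := hY.dotProduct_mulVec_pos hy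
    rw [star_trivial] at this
    linarith
  ext i
  exact Complex.ext (congrFun hx i) (congrFun hy i)

theorem cmapM_mul (A B : MrM n) : cmapM (A * B) = cmapM A * cmapM B :=
  Matrix.map_mul (f := Complex.ofRealHom)

theorem cmapM_transpose (A : MrM n) : cmapM Aᵀ = (cmapM A)ᵀ := rfl

theorem cmapM_conjTranspose (A : MrM n) : (cmapM A)ᴴ = (cmapM A)ᵀ := by
  ext i j
  simp [cmapM]

/-- The block relations of a symplectic matrix, over the complex numbers. -/
theorem IsSymplectic.cmapM_relations {A B C D : MrM n} (h : IsSymplectic A B C D) :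
    (cmapM A)ᵀ * cmapM C = (cmapM C)ᵀ * cmapM A ∧
      (cmapM B)ᵀ * cmapM D = (cmapM D)ᵀ * cmapM B ∧
      (cmapM A)ᵀ * cmapM D = (cmapM C)ᵀ * cmapM B + 1 ∧
      (cmapM D)ᵀ * cmapM A = (cmapM B)ᵀ * cmapM C + 1 := by
  unfold IsSymplectic at h
  simp only [fromBlocks_transpose, fromBlocks_multiply, fromBlocks_inj] at h
  obtain ⟨h1, h2, h3, h4⟩ := h
  have e1 : Aᵀ * C = Cᵀ * A := by
    rw [← sub_eq_zero, ← h1]; noncomm_ring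
  have e2 : Bᵀ * D = Dᵀ * B := by
    rw [← sub_eq_zero, ← h4]; noncomm_ring
  have e3 : Aᵀ * D = Cᵀ * B + 1 := by
    rw [← h2]; noncomm_ring
  have e4 : Dᵀ * A = Bᵀ * C + 1 := by
    rw [← sub_eq_zero, ← neg_inj, neg_zero, ← add_neg_cancel (1 : MrM n), ← h3]; noncomm_ring
  have hadd (P Q : MrM n) : cmapM (P + Q) = cmapM P + cmapM Q :=
    Matrix.map_add _ Complex.ofReal_add P Q
  have hone : cmapM (1 : MrM n) = 1 := Matrix.map_one _ Complex.ofReal_zero Complex.ofReal_one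
  simp only [← cmapM_transpose, ← cmapM_mul, e1, e2, e3, e4, hadd, hone, and_self]

/-- The denominator `CZ + D` is invertible on the Siegel upper half-space. -/
theorem IsSymplectic.isUnit_denom {A B C D : MrM n} (h : IsSymplectic A B C D) {Z : McM n}
    (hZ : inSiegel Z) : IsUnit (cmapM C * Z + cmapM D) := by
  obtain ⟨h1, h2, h3, h4⟩ := h.cmapM_relations
  have hY : Z - Zᴴ = (2 * I) • cmapM (matIm Z) := by
    ext i j
    have := hZ.1.apply i j
    apply Complex.ext <;> simp [cmapM, matIm, this]
    ring
  have hform : (cmapM C * Z + cmapM D)ᴴ * (cmapM A * Z + cmapM B) -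
      (cmapM A * Z + cmapM B)ᴴ * (cmapM C * Z + cmapM D) = (2 * I) • cmapM (matIm Z) := by
    rw [← hY]
    simp only [conjTranspose_add, conjTranspose_mul, cmapM_conjTranspose, add_mul, mul_add,
      mul_assoc]
    simp only [← mul_assoc (cmapM _)ᵀ, h1, h2, h3, h4]
    noncomm_ring
  rw [← Matrix.mulVec_injective_iff_isUnit]
  refine (injective_iff_map_eq_zero (cmapM C * Z + cmapM D).mulVecLin).2 fun v hv => ?_
  rw [mulVecLin_apply] at hv
  refine eq_zero_of_posDef_of_star_dotProduct hZ.2 ?_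
  have := congrArg (fun P : McM n => star v ⬝ᵥ (P *ᵥ v)) hform
  simp only [sub_mulVec, ← mulVec_mulVec, hv, mulVec_zero,
    sub_zero, smul_mulVec, dotProduct_smul] at this
  rw [dotProduct_mulVec, ← star_mulVec, hv, star_zero, zero_dotProduct] at this
  simpa using this.symm

/-- The linear coefficient of the derivative of the symplectic action. -/
theorem IsSymplectic.sub_mul_inv_mul {A B C D : MrM n} (h : IsSymplectic A B C D) {Z : McM n}
    (hZ : inSiegel Z) :
    cmapM A - (cmapM A * Z + cmapM B) * (cmapM C * Z + cmapM D)⁻¹ * cmapM C =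
      ((cmapM C * Z + cmapM D)ᵀ)⁻¹ := by
  obtain ⟨h1, h2, h3, h4⟩ := h.cmapM_relations
  have hM := h.isUnit_denom hZ
  have hdet := (Matrix.isUnit_iff_isUnit_det _).1 hM
  have hsymm : (cmapM C * Z + cmapM D)ᵀ * (cmapM A * Z + cmapM B) =
      (cmapM A * Z + cmapM B)ᵀ * (cmapM C * Z + cmapM D) := by
    simp only [transpose_add, transpose_mul, hZ.1.eq, add_mul, mul_add, mul_assoc]
    simp only [← mul_assoc (cmapM _)ᵀ, h1, h2, h3, h4]
    noncomm_ring
  refine (Matrix.inv_eq_right_inv ?_).symm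
  rw [mul_sub, ← mul_assoc, ← mul_assoc, hsymm, Matrix.mul_nonsing_inv_cancel_right _ _ hdet]
  simp only [transpose_add, transpose_mul, hZ.1.eq, add_mul, mul_assoc, h1, h4]
  noncomm_ring

/-- the map `Z ↦ γZ` on `ℍ_n` (inside the subspace of symmetric complex
matrices) is complex differentiable at every `Z ∈ ℍ_n`, with derivative
`H ↦ (CZ+D)⁻ᵗ H (CZ+D)⁻¹`. -/
theorem symplectic_action_hasFDeriv (n : ℕ) (hn : 1 ≤ n) (A B C D : MrM n)
    (hγ : IsSymplectic A B C D) (Z : McM n) (hZ : inSiegel Z) :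
    HasFDerivWithinAt (fun W : McM n => actS A B C D W)
      (((LinearMap.mulLeft ℂ (((cmapM C * Z + cmapM D)ᵀ)⁻¹)).comp
          (LinearMap.mulRight ℂ ((cmapM C * Z + cmapM D)⁻¹))).toContinuousLinearMap)
      {W : McM n | W.IsSymm} Z ∧
    ∀ H : McM n, H.IsSymm →
      (((LinearMap.mulLeft ℂ (((cmapM C * Z + cmapM D)ᵀ)⁻¹)).comp
          (LinearMap.mulRight ℂ ((cmapM C * Z + cmapM D)⁻¹))).toContinuousLinearMap) H =
        ((cmapM C * Z + cmapM D)ᵀ)⁻¹ * H * (cmapM C * Z + cmapM D)⁻¹ := by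
  refine ⟨?_, fun H _ => by simp [mul_assoc]⟩
  rw [← hγ.sub_mul_inv_mul hZ]
  exact (hasFDerivAt_matrix_moebius _ _ _ _ Z (hγ.isUnit_denom hZ)).hasFDerivWithinAt
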